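/- Let Δ be a finite group, M a finitely generated free ℤ-module with a Δ-action, and I_Δ ⊆ ℤ[Δ] the augmentation ideal. Consider the diagonal Δ-action on (ℤ_p ⊗_ℤ M) ⊗_{ℤ_p} (ℤ_p ⊗_ℤ I_Δ). Then the ℤ_p-rank of the Δ-coinvariants satisfies rank_{ℤ_p} ((ℤ_p ⊗ M) ⊗ (ℤ_p ⊗ I_Δ))_Δ = rank_ℤ M − rank_ℤ M_Δ, where M_Δ denotes the Δ-coinvariants of M. -/

import Mathlib

/-!
STATEMENT 13.  For a finite group Δ and a f.g. free ℤ-module M with Δ-action,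
rank_{ℤ_p} ((ℤ_p ⊗ M) ⊗_{ℤ_p} (ℤ_p ⊗ I_Δ))_Δ = rank_ℤ M − rank_ℤ M_Δ,
with the diagonal Δ-action on the tensor product and I_Δ ⊆ ℤ[Δ] the
augmentation ideal.  Ranks are dimensions of the rationalizations.
-/

open scoped TensorProduct

section Statement13

variable (p : ℕ) [Fact p.Prime]
variable (Δ : Type) [Group Δ] (M : Type) [AddCommGroup M] [DistribMulAction Δ M]

/-- The augmentation map `ℤ[Δ] → ℤ` (sum of coefficients), with `ℤ[Δ]`
realized as `Δ →₀ ℤ`. -/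
noncomputable def augmentation : (Δ →₀ ℤ) →+ ℤ :=
  Finsupp.liftAddHom fun _ => AddMonoidHom.id ℤ

/-- The augmentation ideal `I_Δ ⊆ ℤ[Δ]`, as an additive subgroup. -/
noncomputable def augIdeal : AddSubgroup (Δ →₀ ℤ) := (augmentation Δ).ker

/-- Left multiplication by `d ∈ Δ` on `ℤ[Δ]` preserves the augmentation
ideal; this is the Δ-action on `I_Δ`. -/
noncomputable def smulIdeal (d : Δ) : ↥(augIdeal Δ) →+ ↥(augIdeal Δ) :=
  AddMonoidHom.mk' (fun x => ⟨Finsupp.mapDomain (fun c => d * c) x.1, by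
    have hx := x.2
    simp only [augIdeal, AddMonoidHom.mem_ker] at hx ⊢
    rw [← hx]
    simp only [augmentation, Finsupp.liftAddHom_apply]
    exact Finsupp.sum_mapDomain_index (fun _ => rfl) (fun _ _ _ => rfl)⟩)
  (by
    intro x y
    ext c
    simp [Finsupp.mapDomain_add])

/-- The action of `d ∈ Δ` on `ℤ_p ⊗ M`, through the second factor. -/
noncomputable def actA (d : Δ) :
    (ℤ_[p] ⊗[ℤ] M) →ₗ[ℤ_[p]] (ℤ_[p] ⊗[ℤ] M) :=
  LinearMap.baseChange ℤ_[p] (DistribMulAction.toAddMonoidHom M d).toIntLinearMap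

/-- The action of `d ∈ Δ` on `ℤ_p ⊗ I_Δ`, through the second factor. -/
noncomputable def actB (d : Δ) :
    (ℤ_[p] ⊗[ℤ] ↥(augIdeal Δ)) →ₗ[ℤ_[p]] (ℤ_[p] ⊗[ℤ] ↥(augIdeal Δ)) :=
  LinearMap.baseChange ℤ_[p] (smulIdeal Δ d).toIntLinearMap

/-- The diagonal action of `d ∈ Δ` on `(ℤ_p ⊗ M) ⊗_{ℤ_p} (ℤ_p ⊗ I_Δ)`. -/
noncomputable def actT (d : Δ) :
    ((ℤ_[p] ⊗[ℤ] M) ⊗[ℤ_[p]] (ℤ_[p] ⊗[ℤ] ↥(augIdeal Δ))) →ₗ[ℤ_[p]]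
      ((ℤ_[p] ⊗[ℤ] M) ⊗[ℤ_[p]] (ℤ_[p] ⊗[ℤ] ↥(augIdeal Δ))) :=
  TensorProduct.map (actA p Δ M d) (actB p Δ d)

/-- The submodule of the tensor product generated by `d•t − t`; the
coinvariants are the quotient by this submodule. -/
noncomputable def coinvKer : Submodule ℤ_[p]
    ((ℤ_[p] ⊗[ℤ] M) ⊗[ℤ_[p]] (ℤ_[p] ⊗[ℤ] ↥(augIdeal Δ))) :=
  Submodule.span ℤ_[p] {x | ∃ d t, x = actT p Δ M d t - t}

/-- `rank_{ℤ_p} N := dim_{ℚ_p} (ℚ_p ⊗_{ℤ_p} N)`. -/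
noncomputable def rankZp (N : Type) [AddCommGroup N] [Module ℤ_[p] N] : ℕ :=
  Module.finrank ℚ_[p] (ℚ_[p] ⊗[ℤ_[p]] N)

/-- `rank_ℤ A := dim_ℚ (ℚ ⊗_ℤ A)`. -/
noncomputable def rankZ (A : Type) [AddCommGroup A] : ℕ :=
  Module.finrank ℚ (ℚ ⊗[ℤ] A)

/-- The subgroup of `M` generated by the elements `d•m − m`; the coinvariants
`M_Δ` are the quotient `M ⧸` this subgroup. -/
noncomputable def coinvSubM : AddSubgroup M :=
  AddSubgroup.closure {x : M | ∃ (d : Δ) (m : M), x = d • m - m}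

variable {Δ M} in
/-- The pairing `I_Δ × M → M`, `(x, m) ↦ ∑ x_c • c⁻¹ m`. -/
noncomputable def twistedPairing : ↥(augIdeal Δ) →ₗ[ℤ] (M →ₗ[ℤ] M) :=
  (Finsupp.linearCombination ℤ
    fun c : Δ => (DistribSMul.toAddMonoidHom M c⁻¹).toIntLinearMap) ∘ₗ
    (augIdeal Δ).subtype.toIntLinearMap

variable {Δ M} in
lemma twistedPairing_apply (x : ↥(augIdeal Δ)) (m : M) :
    twistedPairing x m = x.1.sum fun c n => n • (c⁻¹ • m) := by
  simp [twistedPairing, Finsupp.linearCombination_apply, Finsupp.sum, LinearMap.sum_apply]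

variable {Δ M} in
lemma twistedPairing_smulIdeal (d : Δ) (x : ↥(augIdeal Δ)) (m : M) :
    twistedPairing (smulIdeal Δ d x) (d • m) = twistedPairing x m := by
  rw [twistedPairing_apply, twistedPairing_apply]
  change (Finsupp.mapDomain (fun c => d * c) x.1).sum _ = _
  rw [Finsupp.sum_mapDomain_index (h := fun c n => n • (c⁻¹ • d • m))
    (fun _ => zero_smul _ _) (fun _ _ _ => add_smul _ _ _)]
  simp [mul_smul]

/-- The map `(ℤ_p ⊗ M) ⊗ (ℤ_p ⊗ I_Δ) → ℤ_p ⊗ M` induced by `twistedPairing`. -/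
noncomputable def twistedMap :
    ((ℤ_[p] ⊗[ℤ] M) ⊗[ℤ_[p]] (ℤ_[p] ⊗[ℤ] ↥(augIdeal Δ))) →ₗ[ℤ_[p]] (ℤ_[p] ⊗[ℤ] M) :=
  TensorProduct.lift (LinearMap.liftBaseChange ℤ_[p]
    (LinearMap.baseChangeHom ℤ ℤ_[p] M M ∘ₗ twistedPairing)).flip

lemma twistedMap_tmul (a b : ℤ_[p]) (m : M) (x : ↥(augIdeal Δ)) :
    twistedMap p Δ M ((a ⊗ₜ m) ⊗ₜ (b ⊗ₜ x)) = (b * a) ⊗ₜ twistedPairing x m := by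
  simp [twistedMap, TensorProduct.smul_tmul']

lemma twistedMap_comp_actT (d : Δ) : twistedMap p Δ M ∘ₗ actT p Δ M d = twistedMap p Δ M := by
  ext m x
  have h : actT p Δ M d ((1 ⊗ₜ m) ⊗ₜ (1 ⊗ₜ x)) = (1 ⊗ₜ (d • m)) ⊗ₜ (1 ⊗ₜ smulIdeal Δ d x) := by
    simp [actT, actA, actB]
  change twistedMap p Δ M (actT p Δ M d ((1 ⊗ₜ m) ⊗ₜ (1 ⊗ₜ x))) =
    twistedMap p Δ M ((1 ⊗ₜ m) ⊗ₜ (1 ⊗ₜ x))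
  rw [h, twistedMap_tmul, twistedMap_tmul, twistedPairing_smulIdeal]

lemma coinvKer_le_ker_twistedMap : coinvKer p Δ M ≤ LinearMap.ker (twistedMap p Δ M) := by
  refine Submodule.span_le.2 ?_
  rintro _ ⟨d, t, rfl⟩
  have := LinearMap.congr_fun (twistedMap_comp_actT p Δ M d) t
  simpa [sub_eq_zero] using this

/-- The map on coinvariants induced by `twistedMap`. -/
noncomputable def coinvMap :
    (((ℤ_[p] ⊗[ℤ] M) ⊗[ℤ_[p]] (ℤ_[p] ⊗[ℤ] ↥(augIdeal Δ))) ⧸ coinvKer p Δ M) →ₗ[ℤ_[p]]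
      (ℤ_[p] ⊗[ℤ] M) :=
  (coinvKer p Δ M).liftQ (twistedMap p Δ M) (coinvKer_le_ker_twistedMap p Δ M)

variable {Δ} in
/-- The element `c - 1` of the augmentation ideal. -/
noncomputable def subOne (c : Δ) : ↥(augIdeal Δ) :=
  ⟨Finsupp.single c 1 - Finsupp.single 1 1, by
    rw [augIdeal, AddMonoidHom.mem_ker, map_sub]
    simp [augmentation]⟩

lemma twistedPairing_subOne (c : Δ) (m : M) : twistedPairing (subOne c) m = c⁻¹ • m - m := by
  simp [twistedPairing, subOne]

/-- The element `|Δ| - ∑ d` of the augmentation ideal. -/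
noncomputable def cardSubNorm [Fintype Δ] : ↥(augIdeal Δ) := -∑ d : Δ, subOne d

lemma coe_smulIdeal_cardSubNorm [Fintype Δ] (c : Δ) :
    (smulIdeal Δ c (cardSubNorm Δ) : Δ →₀ ℤ) =
      (Fintype.card Δ : ℤ) • Finsupp.single c 1 - ∑ d : Δ, Finsupp.single d 1 := by
  have h : ∀ d : Δ, (smulIdeal Δ c (subOne d) : Δ →₀ ℤ) =
      Finsupp.single (c * d) 1 - Finsupp.single c 1 := fun d => by
    change Finsupp.mapDomain (fun e => c * e) (Finsupp.single d 1 - Finsupp.single 1 1) = _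
    rw [Finsupp.mapDomain_sub, Finsupp.mapDomain_single, Finsupp.mapDomain_single, mul_one]
  rw [cardSubNorm, map_neg, map_sum, AddSubgroup.coe_neg, AddSubgroup.val_finsetSum]
  simp only [h, Finset.sum_sub_distrib, Finset.sum_const, Finset.card_univ, neg_sub]
  rw [natCast_zsmul]
  congr 1
  exact Equiv.sum_comp (Equiv.mulLeft c) fun d => Finsupp.single d (1 : ℤ)

lemma sum_smulIdeal_cardSubNorm [Fintype Δ] (x : ↥(augIdeal Δ)) :
    (x.1.sum fun c n => n • smulIdeal Δ c (cardSubNorm Δ)) = (Fintype.card Δ : ℤ) • x := by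
  have hx : (x.1.sum fun _ n => n) = 0 := x.2
  apply Subtype.ext
  rw [Finsupp.sum, AddSubgroup.val_finsetSum]
  simp only [AddSubgroup.coe_zsmul, coe_smulIdeal_cardSubNorm, smul_sub, Finset.sum_sub_distrib]
  rw [← Finset.sum_smul, show ∑ c ∈ x.1.support, x.1 c = 0 from hx, zero_smul, sub_zero]
  simp only [smul_comm _ (Fintype.card Δ : ℤ)]
  rw [← Finset.smul_sum]
  congr 1
  simpa [Finsupp.sum] using Finsupp.sum_single x.1

variable {Δ M} in
lemma mkQ_smul_tmul (d : Δ) (m : M) (x : ↥(augIdeal Δ)) :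
    (coinvKer p Δ M).mkQ ((1 ⊗ₜ (d⁻¹ • m)) ⊗ₜ (1 ⊗ₜ x)) =
      (coinvKer p Δ M).mkQ ((1 ⊗ₜ m) ⊗ₜ (1 ⊗ₜ smulIdeal Δ d x)) := by
  symm
  refine (Submodule.Quotient.eq _).2 (Submodule.subset_span ⟨d, (1 ⊗ₜ (d⁻¹ • m)) ⊗ₜ (1 ⊗ₜ x), ?_⟩)
  simp [actT, actA, actB]

/-- The map `m ↦ m ⊗ (|Δ| - ∑ d)` to the coinvariants. -/
noncomputable def coinvTransfer [Fintype Δ] : (ℤ_[p] ⊗[ℤ] M) →ₗ[ℤ_[p]]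
    (((ℤ_[p] ⊗[ℤ] M) ⊗[ℤ_[p]] (ℤ_[p] ⊗[ℤ] ↥(augIdeal Δ))) ⧸ coinvKer p Δ M) :=
  (coinvKer p Δ M).mkQ ∘ₗ (TensorProduct.mk ℤ_[p] _ _).flip (1 ⊗ₜ cardSubNorm Δ)

lemma coinvTransfer_comp_coinvMap [Fintype Δ] :
    coinvTransfer p Δ M ∘ₗ coinvMap p Δ M = (Fintype.card Δ : ℤ_[p]) • LinearMap.id := by
  ext m x
  change coinvTransfer p Δ M (twistedMap p Δ M ((1 ⊗ₜ m) ⊗ₜ (1 ⊗ₜ x))) =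
    (Fintype.card Δ : ℤ_[p]) • (coinvKer p Δ M).mkQ ((1 ⊗ₜ m) ⊗ₜ (1 ⊗ₜ x))
  let f : M →+ _ := (coinvTransfer p Δ M).toAddMonoidHom.comp
    (TensorProduct.mk ℤ ℤ_[p] M 1).toAddMonoidHom
  let g : ↥(augIdeal Δ) →+ _ := ((coinvKer p Δ M).mkQ ∘ₗ
    TensorProduct.mk ℤ_[p] _ _ (1 ⊗ₜ m)).toAddMonoidHom.comp
    (TensorProduct.mk ℤ ℤ_[p] ↥(augIdeal Δ) 1).toAddMonoidHom
  have hfg : ∀ c : Δ, f (c⁻¹ • m) = g (smulIdeal Δ c (cardSubNorm Δ)) :=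
    fun c => mkQ_smul_tmul p c m _
  rw [twistedMap_tmul, mul_one, twistedPairing_apply]
  change f _ = (Fintype.card Δ : ℤ_[p]) • g x
  rw [Finsupp.sum, map_sum]
  simp only [map_zsmul, hfg]
  simp only [← map_zsmul g]
  rw [← map_sum]
  change g (x.1.sum fun c n => n • smulIdeal Δ c (cardSubNorm Δ)) = _
  rw [sum_smulIdeal_cardSubNorm, map_zsmul, natCast_zsmul, Nat.cast_smul_eq_nsmul]

lemma exact_coinvMap : Function.Exact (coinvMap p Δ M)
    (LinearMap.baseChange ℤ_[p] (QuotientAddGroup.mk' (coinvSubM Δ M)).toIntLinearMap) := by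
  have hex : Function.Exact (coinvSubM Δ M).subtype.toIntLinearMap
      (QuotientAddGroup.mk' (coinvSubM Δ M)).toIntLinearMap := fun m => by
    simp [QuotientAddGroup.eq_zero_iff]
  have hex' := lTensor_exact ℤ_[p] hex (QuotientAddGroup.mk'_surjective _)
  have key : ∀ m ∈ coinvSubM Δ M, ∀ a : ℤ_[p],
      a ⊗ₜ[ℤ] m ∈ LinearMap.range (coinvMap p Δ M) := fun m hm a => by
    induction hm using AddSubgroup.closure_induction with
    | mem y hy =>
      obtain ⟨d, m, rfl⟩ := hy
      refine ⟨(coinvKer p Δ M).mkQ ((a ⊗ₜ m) ⊗ₜ (1 ⊗ₜ subOne d⁻¹)), ?_⟩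
      change twistedMap p Δ M ((a ⊗ₜ m) ⊗ₜ (1 ⊗ₜ subOne d⁻¹)) = _
      rw [twistedMap_tmul, one_mul, twistedPairing_subOne, inv_inv]
    | zero => simp
    | add y z _ _ hy hz => rw [TensorProduct.tmul_add]; exact add_mem hy hz
    | neg y _ hy => rw [TensorProduct.tmul_neg]; exact neg_mem hy
  rw [LinearMap.exact_iff]
  apply le_antisymm
  · intro y hy
    obtain ⟨z, rfl⟩ := (hex' y).1 hy
    clear hy
    induction z using TensorProduct.induction_on with
    | zero => simp
    | tmul a m => exact key m.1 m.2 a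
    | add z w hz hw => rw [map_add]; exact add_mem hz hw
  · rw [LinearMap.range_le_ker_iff]
    ext m x
    change LinearMap.baseChange ℤ_[p] (QuotientAddGroup.mk' (coinvSubM Δ M)).toIntLinearMap
      (twistedMap p Δ M ((1 ⊗ₜ m) ⊗ₜ (1 ⊗ₜ x))) = 0
    have hx : (x.1.sum fun _ n => n) = 0 := x.2
    have hm : ∀ c : Δ, QuotientAddGroup.mk' (coinvSubM Δ M) (c⁻¹ • m) =
        QuotientAddGroup.mk' (coinvSubM Δ M) m := fun c =>
      sub_eq_zero.1 <| by
        rw [← map_sub]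
        exact (QuotientAddGroup.eq_zero_iff _).2 (AddSubgroup.subset_closure ⟨c⁻¹, m, rfl⟩)
    rw [twistedMap_tmul, LinearMap.baseChange_tmul, AddMonoidHom.coe_toIntLinearMap,
      twistedPairing_apply, Finsupp.sum, map_sum]
    simp only [map_zsmul, hm]
    rw [← Finset.sum_smul, show ∑ c ∈ x.1.support, x.1 c = 0 from hx, zero_smul,
      TensorProduct.tmul_zero]

lemma finrank_baseChange_padic (A : Type) [AddCommGroup A] :
    Module.finrank ℚ_[p] (ℚ_[p] ⊗[ℤ_[p]] (ℤ_[p] ⊗[ℤ] A)) = rankZ A := by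
  rw [(TensorProduct.AlgebraTensorModule.cancelBaseChange ℤ ℤ_[p] ℚ_[p] ℚ_[p] A).finrank_eq,
    ← (TensorProduct.AlgebraTensorModule.cancelBaseChange ℤ ℚ ℚ_[p] ℚ_[p] A).finrank_eq,
    Module.finrank_baseChange, rankZ]

theorem statement13 [Finite Δ] [Module.Free ℤ M] [Module.Finite ℤ M] :
    rankZp p (((ℤ_[p] ⊗[ℤ] M) ⊗[ℤ_[p]] (ℤ_[p] ⊗[ℤ] ↥(augIdeal Δ))) ⧸ coinvKer p Δ M)
      = rankZ M - rankZ (M ⧸ coinvSubM Δ M) := by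
  have := Fintype.ofFinite Δ
  let f := LinearMap.baseChange ℚ_[p] (coinvMap p Δ M)
  let g := LinearMap.baseChange ℚ_[p] (LinearMap.baseChange ℤ_[p]
    (QuotientAddGroup.mk' (coinvSubM Δ M)).toIntLinearMap)
  have hq : Function.Surjective (LinearMap.baseChange ℤ_[p]
      (QuotientAddGroup.mk' (coinvSubM Δ M)).toIntLinearMap) :=
    LinearMap.lTensor_surjective _ (QuotientAddGroup.mk'_surjective _)
  have hg : Function.Surjective g := LinearMap.lTensor_surjective _ hq
  have hfg : Function.Exact f g := lTensor_exact ℚ_[p] (exact_coinvMap p Δ M) hq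
  have hf : Function.Injective f := by
    have h : LinearMap.baseChange ℚ_[p] (coinvTransfer p Δ M) ∘ₗ f =
        (Fintype.card Δ : ℚ_[p]) • LinearMap.id := by
      rw [← LinearMap.baseChange_comp, coinvTransfer_comp_coinvMap, LinearMap.baseChange_smul,
        LinearMap.baseChange_id]
      ext
      simp [Nat.cast_smul_eq_nsmul]
    have hinj : Function.Injective (LinearMap.baseChange ℚ_[p] (coinvTransfer p Δ M) ∘ₗ f) := by
      rw [h]
      exact smul_right_injective _
        (show (Fintype.card Δ : ℚ_[p]) ≠ 0 from Nat.cast_ne_zero.2 Fintype.card_ne_zero)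
    exact Function.Injective.of_comp hinj
  have hrank := LinearMap.finrank_range_add_finrank_ker g
  rw [LinearMap.range_eq_top.2 hg, finrank_top, hfg.linearMap_ker_eq,
    LinearMap.finrank_range_of_inj hf, finrank_baseChange_padic, finrank_baseChange_padic] at hrank
  rw [rankZp, ← hrank, Nat.add_sub_cancel_left]

end Statement13
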